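/- arXiv:1307.6895 — 2 statements merged into one kernel-verified Lean document; each statement's English description precedes it below -/
import Mathlib

section
/- Let σ > 0, t > 0 and f ∈ L¹(ℝ) with f = 0 almost everywhere on (0, ∞). Then: (i) for every x ≥ 0, ∫_ℝ S_σ(x, y, t) f(y) dy = ∫_ℝ S(x − y; t) (f + ρ_σ ⋆ f)(y) dy; (ii) for every x ≤ 0, ∫_ℝ S_σ(x, y, t) f(y) dy = ∫_ℝ S(x − y; t) f(y) dy + ∫_ℝ S(−x − y; t) (ρ_σ ⋆ f)(y) dy. Here ⋆ denotes convolution on ℝ and S_σ(x, y, t) = S(x − y; t) − (σ/2) ∫₀^∞ e^{−σu/2} S(u + |x| + |y|; t) du. -/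
open MeasureTheory

/-- The free Schrödinger kernel `S(x; t) = e^{−x²/(4it)} / (4πit)^{1/2}` (principal branch). -/
noncomputable def freeKernel (t x : ℝ) : ℂ :=
  Complex.exp (-(x : ℂ) ^ 2 / (4 * Complex.I * t)) /
    ((4 * (Real.pi : ℂ) * Complex.I * t) ^ (1 / 2 : ℂ))

/-- The fundamental solution of `i∂ₜu = −(Δ + σδ)u` for `σ > 0`. -/
noncomputable def deltaKernel (σ t x y : ℝ) : ℂ :=
  freeKernel t (x - y) -
    ((σ / 2 : ℝ) : ℂ) *
      ∫ u in Set.Ioi (0 : ℝ), ((Real.exp (-(σ * u) / 2) : ℝ) : ℂ) * freeKernel t (u + |x| + |y|)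

/-- `ρ_σ(x) = −(σ/2) e^{σx/2}` for `x ≤ 0`, `ρ_σ(x) = 0` for `x > 0` (case `σ > 0`). -/
noncomputable def rhoSigma (σ : ℝ) : ℝ → ℂ := fun x =>
  if x ≤ 0 then ((-(σ / 2) * Real.exp (σ * x / 2) : ℝ) : ℂ) else 0

/-- Convolution `(ρ_σ ⋆ f)(z) = ∫ ρ_σ(z − y) f(y) dy`. -/
noncomputable def rhoConv (σ : ℝ) (f : ℝ → ℂ) : ℝ → ℂ := fun z =>
  ∫ y : ℝ, rhoSigma σ (z - y) * f y

theorem continuous_freeKernel (t : ℝ) : Continuous (freeKernel t) := by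
  unfold freeKernel
  fun_prop

theorem norm_freeKernel (t x : ℝ) :
    ‖freeKernel t x‖ = ‖(4 * (Real.pi : ℂ) * Complex.I * t) ^ (1 / 2 : ℂ)‖⁻¹ := by
  have h : -(x : ℂ) ^ 2 / (4 * Complex.I * t) = ((x ^ 2 / (4 * t) : ℝ) : ℂ) * Complex.I := by
    rcases eq_or_ne t 0 with rfl | ht
    · simp
    · have : (t : ℂ) ≠ 0 := by exact_mod_cast ht
      push_cast
      field_simp
      simp
  rw [freeKernel, norm_div, h, Complex.norm_exp_ofReal_mul_I, one_div]

theorem MeasureTheory.Integrable.freeKernel_mul {α : Type*} [MeasurableSpace α] {μ : Measure α}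
    {g : α → ℂ} (hg : Integrable g μ) (t : ℝ) {φ : α → ℝ} (hφ : Measurable φ) :
    Integrable (fun a => freeKernel t (φ a) * g a) μ :=
  hg.bdd_mul ((continuous_freeKernel t).measurable.comp hφ).aestronglyMeasurable
    (Filter.Eventually.of_forall fun a => (norm_freeKernel t (φ a)).le)

theorem rhoSigma_neg_eq_indicator (σ : ℝ) :
    (fun u => rhoSigma σ (-u)) = (Set.Ici (0 : ℝ)).indicator
      (fun u => ((-(σ / 2) * Real.exp (-(σ * u) / 2) : ℝ) : ℂ)) := by
  ext u
  simp [rhoSigma, Set.indicator_apply]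

theorem integrable_rhoSigma {σ : ℝ} (hσ : 0 < σ) : Integrable (rhoSigma σ) := by
  suffices h : Integrable fun u => rhoSigma σ (-u) by simpa using h.comp_neg
  rw [rhoSigma_neg_eq_indicator,
    integrable_indicator_iff measurableSet_Ici, integrableOn_Ici_iff_integrableOn_Ioi]
  refine Integrable.ofReal (Integrable.const_mul ?_ _)
  refine (exp_neg_integrableOn_Ioi 0 (half_pos hσ)).congr_fun (fun u _ => ?_) measurableSet_Ioi
  ring_nf

theorem integrable_rhoSigma_sub_mul {σ : ℝ} (hσ : 0 < σ) {f : ℝ → ℂ} (hf : Integrable f) :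
    Integrable (fun p : ℝ × ℝ => rhoSigma σ (p.1 - p.2) * f p.2) (volume.prod volume) := by
  simpa [mul_comm] using hf.convolution_integrand (ContinuousLinearMap.mul ℝ ℂ)
    (integrable_rhoSigma hσ)

theorem integrable_rhoConv {σ : ℝ} (hσ : 0 < σ) {f : ℝ → ℂ} (hf : Integrable f) :
    Integrable (rhoConv σ f) :=
  (integrable_rhoSigma_sub_mul hσ hf).integral_prod_left

theorem integral_freeKernel_mul_rhoSigma (σ t w y : ℝ) :
    ∫ z : ℝ, freeKernel t (w - z) * rhoSigma σ (z - y) =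
      -(((σ / 2 : ℝ) : ℂ) * ∫ u in Set.Ioi (0 : ℝ),
        ((Real.exp (-(σ * u) / 2) : ℝ) : ℂ) * freeKernel t (u + w - y)) := by
  have h := integral_sub_left_eq_self
    (fun z => freeKernel t (w - z) * rhoSigma σ (z - y)) volume y
  rw [← h, ← integral_Ici_eq_integral_Ioi, ← integral_indicator measurableSet_Ici,
    ← integral_const_mul, ← integral_neg]
  refine integral_congr_ae (Filter.Eventually.of_forall fun u => ?_)
  have hu := congrFun (rhoSigma_neg_eq_indicator σ) u
  have e₁ : y - u - y = -u := by ring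
  have e₂ : w - (y - u) = u + w - y := by ring
  simp only [e₁, e₂]
  simp only [hu, Set.indicator_apply]
  split_ifs
  · push_cast
    ring
  · simp

theorem integral_freeKernel_mul_rhoConv {σ : ℝ} (hσ : 0 < σ) (t w : ℝ) {f : ℝ → ℂ}
    (hf : Integrable f) :
    Integrable (fun y => (∫ z : ℝ, freeKernel t (w - z) * rhoSigma σ (z - y)) * f y) ∧
      ∫ z : ℝ, freeKernel t (w - z) * rhoConv σ f z =
        ∫ y : ℝ, (∫ z : ℝ, freeKernel t (w - z) * rhoSigma σ (z - y)) * f y := by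
  have h := (integrable_rhoSigma_sub_mul hσ hf).freeKernel_mul t
    (φ := fun p : ℝ × ℝ => w - p.1) (by fun_prop)
  simp only [← integral_mul_const, rhoConv, ← integral_const_mul, mul_assoc]
  exact ⟨h.integral_prod_right, integral_integral_swap h⟩

theorem integral_deltaKernel_mul {σ : ℝ} (hσ : 0 < σ) (t x : ℝ) {f : ℝ → ℂ}
    (hf : Integrable f) (hsupp : ∀ᵐ y : ℝ, 0 < y → f y = 0) :
    ∫ y : ℝ, deltaKernel σ t x y * f y =
      (∫ y : ℝ, freeKernel t (x - y) * f y) +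
        ∫ y : ℝ, freeKernel t (|x| - y) * rhoConv σ f y := by
  obtain ⟨hint, heq⟩ := integral_freeKernel_mul_rhoConv hσ t |x| hf
  rw [heq, ← integral_add (hf.freeKernel_mul t (by fun_prop)) hint]
  refine integral_congr_ae ?_
  filter_upwards [hsupp] with y hy
  rcases lt_or_ge 0 y with h | h
  · simp [hy h]
  · rw [integral_freeKernel_mul_rhoSigma, deltaKernel, abs_of_nonpos h]
    simp only [← sub_eq_add_neg]
    ring

theorem stmt12 (σ t : ℝ) (hσ : 0 < σ) (ht : 0 < t) (f : ℝ → ℂ)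
    (hf : Integrable f) (hsupp : ∀ᵐ x : ℝ, 0 < x → f x = 0) :
    (∀ x : ℝ, 0 ≤ x →
      ∫ y : ℝ, deltaKernel σ t x y * f y
        = ∫ y : ℝ, freeKernel t (x - y) * (f y + rhoConv σ f y)) ∧
    (∀ x : ℝ, x ≤ 0 →
      ∫ y : ℝ, deltaKernel σ t x y * f y
        = (∫ y : ℝ, freeKernel t (x - y) * f y)
          + ∫ y : ℝ, freeKernel t (-x - y) * rhoConv σ f y) := by
  refine ⟨fun x hx => ?_, fun x hx => ?_⟩
  · rw [integral_deltaKernel_mul hσ t x hf hsupp, abs_of_nonneg hx]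
    simp only [mul_add]
    exact (integral_add (hf.freeKernel_mul t (by fun_prop))
      ((integrable_rhoConv hσ hf).freeKernel_mul t (by fun_prop))).symm
  · rw [integral_deltaKernel_mul hσ t x hf hsupp, abs_of_nonpos hx]
end

section
/- Let n ≥ 1, ρ ∈ ℕ with ρ ≥ 1, λ ∈ {1, −1} ⊂ ℂ, and let a₀, b : ℤⁿ → ℂ be summable, with ℓ¹ norm ‖·‖₁. Then there exists T > 0 such that there is a function u : (−T, T) → (ℤⁿ → ℂ) with each u(t) summable, s ↦ u(s)(m) measurable for each m, and sup_{|t|<T} ‖u(t)‖₁ ≤ 2‖a₀‖₁, satisfying for all t ∈ (−T, T) and all m ∈ ℤⁿ the integral equation u(t)(m) = e^{−4π²i|m|²t} a₀(m) + ∫₀ᵗ e^{−4π²i|m|²(t−s)} [ (b ⋆ u(s))(m) + λ (u(s))^{⋆ρ}(m) ] ds; moreover u is the unique such function satisfying sup_{|t|<T} ‖u(t)‖₁ ≤ 2‖a₀‖₁. -/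
open MeasureTheory

/-- Discrete convolution on `ℤⁿ`: `(f ⋆ g)(m) = ∑_{ξ ∈ ℤⁿ} f(m − ξ) g(ξ)`. -/
noncomputable def dConv {n : ℕ} (f g : (Fin n → ℤ) → ℂ) : (Fin n → ℤ) → ℂ :=
  fun m => ∑' ξ : Fin n → ℤ, f (m - ξ) * g ξ

/-- The `ρ`-fold convolution power `f^{⋆ρ}` (with `f^{⋆0}` the convolution identity `δ₀`). -/
noncomputable def dConvPow {n : ℕ} (f : (Fin n → ℤ) → ℂ) : ℕ → ((Fin n → ℤ) → ℂ)
  | 0 => fun m => if m = 0 then 1 else 0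
  | k + 1 => dConv f (dConvPow f k)

/-- `u : (−T, T) → ℓ¹(ℤⁿ)` is a mild solution (on the Fourier side) of the periodic NLS
`i∂ₜu + Δu + μu = λ uᵖ` with data `a₀ = û₀`, potential coefficients `b = μ̂`, bounded by
`2‖a₀‖₁`: it is summable, measurable in time, satisfies the bound, and solves the Duhamel
integral equation coefficientwise. -/
def IsMildSol {n : ℕ} (ρ : ℕ) (lam : ℂ) (a₀ b : (Fin n → ℤ) → ℂ) (T : ℝ)
    (u : ℝ → (Fin n → ℤ) → ℂ) : Prop :=
  (∀ t ∈ Set.Ioo (-T) T, Summable fun m => ‖u t m‖) ∧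
  (∀ m : Fin n → ℤ, Measurable fun s => u s m) ∧
  (∀ t ∈ Set.Ioo (-T) T, (∑' m : Fin n → ℤ, ‖u t m‖) ≤ 2 * ∑' m : Fin n → ℤ, ‖a₀ m‖) ∧
  (∀ t ∈ Set.Ioo (-T) T, ∀ m : Fin n → ℤ,
    u t m =
      Complex.exp (-(4 * (Real.pi : ℂ) ^ 2) * Complex.I *
          ((∑ i, (m i : ℝ) ^ 2 : ℝ) : ℂ) * (t : ℂ)) * a₀ m
        + ∫ s in (0 : ℝ)..t,
            Complex.exp (-(4 * (Real.pi : ℂ) ^ 2) * Complex.I *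
                ((∑ i, (m i : ℝ) ^ 2 : ℝ) : ℂ) * ((t : ℂ) - (s : ℂ))) *
              ((∑' ξ : Fin n → ℤ, b (m - ξ) * u s ξ) + lam * dConvPow (u s) ρ m))

open Set Metric Filter Topology
open scoped NNReal

/-- The space `ℓ¹(ℤⁿ)` of Fourier coefficients of elements of `I_per`. -/
noncomputable abbrev FourierL1 (n : ℕ) := lp (fun _ : Fin n → ℤ => ℂ) 1

namespace FourierL1

variable {n : ℕ}

lemma memℓp_one_iff {f : (Fin n → ℤ) → ℂ} : Memℓp f 1 ↔ Summable fun m => ‖f m‖ := by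
  simpa using memℓp_gen_iff (p := 1) (f := f) (by simp)

lemma summable_norm (f : FourierL1 n) : Summable fun m => ‖f m‖ :=
  memℓp_one_iff.1 (lp.memℓp f)

lemma norm_eq_tsum (f : FourierL1 n) : ‖f‖ = ∑' m, ‖f m‖ := by
  simpa using lp.norm_eq_tsum_rpow (p := 1) (by simp) f

/-- A curve in `ℓ¹(ℤⁿ)` is strongly measurable as soon as its coefficients are measurable. -/
lemma stronglyMeasurable_of_apply {α : Type*} [MeasurableSpace α] {V : α → FourierL1 n}
    (hV : ∀ m, Measurable fun s => V s m) : StronglyMeasurable V := by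
  refine stronglyMeasurable_of_tendsto (atTop : Filter (Finset (Fin n → ℤ)))
    (f := fun S s => ∑ m ∈ S, lp.single 1 m (V s m)) (fun S => ?_) ?_
  · refine Finset.stronglyMeasurable_fun_sum S fun m _ => ?_
    exact (lp.singleContinuousLinearMap ℂ (fun _ : Fin n → ℤ => ℂ) 1 m).continuous
      |>.comp_stronglyMeasurable (hV m).stronglyMeasurable
  · exact tendsto_pi_nhds.2 fun s => lp.hasSum_single (by simp) (V s)

/-! ### Convolution -/

lemma summable_norm_mul_sub (f g : FourierL1 n) :
    Summable fun p : (Fin n → ℤ) × (Fin n → ℤ) => ‖f (p.1 - p.2)‖ * ‖g p.2‖ := by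
  have h := (summable_norm f).mul_of_nonneg (summable_norm g) (fun _ => norm_nonneg _)
    (fun _ => norm_nonneg _)
  let e : (Fin n → ℤ) × (Fin n → ℤ) ≃ (Fin n → ℤ) × (Fin n → ℤ) :=
    ⟨fun p => (p.1 - p.2, p.2), fun p => (p.1 + p.2, p.2), fun p => by simp, fun p => by simp⟩
  exact (e.summable_iff (f := fun p : (Fin n → ℤ) × (Fin n → ℤ) => ‖f p.1‖ * ‖g p.2‖)).2 h

lemma tsum_norm_mul_sub (f g : FourierL1 n) :
    ∑' m, ∑' ξ, ‖f (m - ξ)‖ * ‖g ξ‖ = ‖f‖ * ‖g‖ := by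
  rw [Summable.tsum_comm (f := fun ξ m => ‖f (m - ξ)‖ * ‖g ξ‖)
      ((Equiv.prodComm _ _).summable_iff.2 (summable_norm_mul_sub f g)),
    norm_eq_tsum f, norm_eq_tsum g, ← tsum_mul_left]
  refine tsum_congr fun ξ => ?_
  exact tsum_mul_right.trans
    (congrArg (· * ‖g ξ‖) ((Equiv.subRight ξ).tsum_eq fun m => ‖f m‖))

lemma summable_mul_sub (f g : FourierL1 n) (m : Fin n → ℤ) :
    Summable fun ξ => f (m - ξ) * g ξ :=
  .of_norm <| by simpa using (summable_norm_mul_sub f g).prod_factor m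

lemma norm_dConv_le (f g : FourierL1 n) (m : Fin n → ℤ) :
    ‖dConv f g m‖ ≤ ∑' ξ, ‖f (m - ξ)‖ * ‖g ξ‖ := by
  have h := (summable_norm_mul_sub f g).prod_factor m
  simpa [dConv] using norm_tsum_le_tsum_norm (f := fun ξ => f (m - ξ) * g ξ) (by simpa using h)

lemma summable_norm_dConv (f g : FourierL1 n) : Summable fun m => ‖dConv f g m‖ :=
  .of_nonneg_of_le (fun _ => norm_nonneg _) (norm_dConv_le f g) (summable_norm_mul_sub f g).prod

/-- Discrete convolution as a continuous bilinear map on `ℓ¹(ℤⁿ)`. -/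
noncomputable def conv : FourierL1 n →L[ℂ] FourierL1 n →L[ℂ] FourierL1 n :=
  LinearMap.mkContinuous₂
    (LinearMap.mk₂ ℂ
      (fun f g : FourierL1 n =>
        (⟨dConv f g, memℓp_one_iff.2 (summable_norm_dConv f g)⟩ : FourierL1 n))
      (fun f f' g => by
        ext m
        exact (tsum_congr fun ξ => add_mul _ _ _).trans
          ((summable_mul_sub f g m).tsum_add (summable_mul_sub f' g m)))
      (fun c f g => by
        ext m
        simp [dConv, mul_assoc, tsum_mul_left])
      (fun f g g' => by
        ext m
        exact (tsum_congr fun ξ => mul_add _ _ _).trans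
          ((summable_mul_sub f g m).tsum_add (summable_mul_sub f g' m)))
      (fun c f g => by
        ext m
        simp [dConv, mul_left_comm, tsum_mul_left])) 1
    (fun f g => by
      rw [one_mul, ← tsum_norm_mul_sub, norm_eq_tsum]
      exact (summable_norm_dConv f g).tsum_le_tsum (norm_dConv_le f g)
        (summable_norm_mul_sub f g).prod)

lemma coe_conv (f g : FourierL1 n) : ⇑(conv f g) = dConv f g := rfl

lemma norm_conv_le (f g : FourierL1 n) : ‖conv f g‖ ≤ ‖f‖ * ‖g‖ := by
  have h : ‖conv (n := n)‖ ≤ 1 := LinearMap.mkContinuous₂_norm_le _ zero_le_one _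
  calc ‖conv f g‖ ≤ ‖conv (n := n)‖ * ‖f‖ * ‖g‖ := conv.le_opNorm₂ f g
    _ ≤ 1 * ‖f‖ * ‖g‖ := by gcongr
    _ = ‖f‖ * ‖g‖ := by rw [one_mul]

/-- Convolution powers in `ℓ¹(ℤⁿ)`. -/
noncomputable def convPow (f : FourierL1 n) : ℕ → FourierL1 n
  | 0 => lp.single 1 0 1
  | k + 1 => conv f (convPow f k)

lemma coe_convPow (f : FourierL1 n) (k : ℕ) : ⇑(convPow f k) = dConvPow f k := by
  induction k with
  | zero => ext m; simp [convPow, dConvPow, Pi.single_apply]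
  | succ k ih => rw [convPow, dConvPow, coe_conv, ih]

lemma continuous_convPow (k : ℕ) : Continuous fun f : FourierL1 n => convPow f k := by
  induction k with
  | zero => exact continuous_const
  | succ k ih => exact (conv.continuous.clm_apply ih :)

lemma norm_convPow_le {r : ℝ} {f : FourierL1 n} (hf : ‖f‖ ≤ r) (k : ℕ) :
    ‖convPow f k‖ ≤ r ^ k := by
  induction k with
  | zero => simp [convPow, lp.norm_single]
  | succ k ih =>
    rw [convPow, pow_succ']
    exact (norm_conv_le _ _).trans
      (mul_le_mul hf ih (norm_nonneg _) ((norm_nonneg _).trans hf))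

lemma exists_norm_convPow_sub_le {r : ℝ} (hr : 0 ≤ r) (k : ℕ) :
    ∃ K : ℝ≥0, ∀ f g : FourierL1 n, ‖f‖ ≤ r → ‖g‖ ≤ r →
      ‖convPow f k - convPow g k‖ ≤ K * ‖f - g‖ := by
  lift r to ℝ≥0 using hr
  induction k with
  | zero => exact ⟨0, fun f g _ _ => by simp [convPow]⟩
  | succ k ih =>
    obtain ⟨K, hK⟩ := ih
    refine ⟨r ^ k + r * K, fun f g hf hg => ?_⟩
    have h : conv f (convPow f k) - conv g (convPow g k)
        = conv (f - g) (convPow f k) + conv g (convPow f k - convPow g k) := by simp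
    rw [convPow, convPow, h]
    calc _ ≤ ‖f - g‖ * ‖convPow f k‖ + ‖g‖ * ‖convPow f k - convPow g k‖ :=
          (norm_add_le _ _).trans (add_le_add (norm_conv_le _ _) (norm_conv_le _ _))
      _ ≤ ‖f - g‖ * r ^ k + r * (K * ‖f - g‖) := by
          gcongr
          · exact norm_convPow_le hf k
          · exact hK f g hf hg
      _ = _ := by push_cast; ring

/-! ### The nonlinearity -/

/-- The Fourier-side forcing term `u ↦ b ⋆ u + λ u^{⋆ρ}`. -/
noncomputable def forcing (ρ : ℕ) (lam : ℂ) (b f : FourierL1 n) : FourierL1 n :=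
  conv b f + lam • convPow f ρ

lemma forcing_apply (ρ : ℕ) (lam : ℂ) (b f : FourierL1 n) (m : Fin n → ℤ) :
    forcing ρ lam b f m = (∑' ξ, b (m - ξ) * f ξ) + lam * dConvPow f ρ m := by
  rw [← coe_convPow]
  rfl

lemma forcing_zero {ρ : ℕ} (hρ : 1 ≤ ρ) (lam : ℂ) (b : FourierL1 n) :
    forcing ρ lam b 0 = 0 := by
  obtain ⟨k, rfl⟩ := Nat.exists_eq_add_of_le' hρ
  simp [forcing, convPow]

lemma continuous_forcing (ρ : ℕ) (lam : ℂ) (b : FourierL1 n) : Continuous (forcing ρ lam b) :=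
  (conv b).continuous.add ((continuous_convPow ρ).const_smul lam)

lemma exists_norm_forcing_sub_le (ρ : ℕ) (lam : ℂ) (b : FourierL1 n) {r : ℝ} (hr : 0 ≤ r) :
    ∃ K : ℝ≥0, ∀ f g : FourierL1 n, ‖f‖ ≤ r → ‖g‖ ≤ r →
      ‖forcing ρ lam b f - forcing ρ lam b g‖ ≤ K * ‖f - g‖ := by
  obtain ⟨K, hK⟩ := exists_norm_convPow_sub_le (n := n) hr ρ
  refine ⟨‖b‖₊ + ‖lam‖₊ * K, fun f g hf hg => ?_⟩
  have h : forcing ρ lam b f - forcing ρ lam b g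
      = conv b (f - g) + lam • (convPow f ρ - convPow g ρ) := by
    simp only [forcing, map_sub, smul_sub]; abel
  rw [h]
  calc _ ≤ ‖b‖ * ‖f - g‖ + ‖lam‖ * (K * ‖f - g‖) := by
        refine (norm_add_le _ _).trans (add_le_add (norm_conv_le _ _) ?_)
        rw [norm_smul]
        gcongr
        exact hK f g hf hg
    _ = _ := by push_cast; ring

/-! ### The free propagator -/

/-- The multiplier `e^{-4π²i|m|²t}` of the free Schrödinger group. -/
noncomputable def phase (m : Fin n → ℤ) (t : ℝ) : ℂ :=
  Complex.exp (-(4 * (Real.pi : ℂ) ^ 2) * Complex.I *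
    ((∑ i, (m i : ℝ) ^ 2 : ℝ) : ℂ) * (t : ℂ))

lemma norm_phase (m : Fin n → ℤ) (t : ℝ) : ‖phase m t‖ = 1 := by
  have h : -(4 * (Real.pi : ℂ) ^ 2) * Complex.I * ((∑ i, (m i : ℝ) ^ 2 : ℝ) : ℂ) * (t : ℂ)
      = ((-(4 * Real.pi ^ 2) * (∑ i, (m i : ℝ) ^ 2) * t : ℝ) : ℂ) * Complex.I := by
    push_cast; ring
  rw [phase, h, Complex.norm_exp_ofReal_mul_I]

lemma phase_add (m : Fin n → ℤ) (s t : ℝ) : phase m (s + t) = phase m s * phase m t := by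
  rw [phase, phase, phase, ← Complex.exp_add]
  congr 1
  push_cast
  ring

lemma continuous_phase (m : Fin n → ℤ) : Continuous (phase m) := by
  unfold phase
  fun_prop

/-- The free Schrödinger group on Fourier coefficients. -/
noncomputable def propagator (t : ℝ) : FourierL1 n →ₗᵢ[ℂ] FourierL1 n where
  toFun f := ⟨fun m => phase m t * f m,
    memℓp_one_iff.2 (by simpa [norm_phase] using summable_norm f)⟩
  map_add' f g := by ext m; exact mul_add _ _ _
  map_smul' c f := by ext m; exact mul_left_comm _ _ _
  norm_map' f := by simp [norm_eq_tsum, norm_phase]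

lemma propagator_apply (t : ℝ) (f : FourierL1 n) (m : Fin n → ℤ) :
    propagator t f m = phase m t * f m := rfl

lemma continuous_propagator_apply (f : FourierL1 n) : Continuous fun t => propagator t f := by
  have h : (fun t => propagator t f) = fun t => ∑' m, lp.single 1 m (phase m t * f m) :=
    funext fun t => (lp.hasSum_single (by simp) (propagator t f)).tsum_eq.symm
  rw [h]
  refine continuous_tsum (fun m => ?_) (summable_norm f) fun m t => ?_
  · exact (lp.singleContinuousLinearMap ℂ (fun _ : Fin n → ℤ => ℂ) 1 m).continuous.comp
      ((continuous_phase m).mul continuous_const)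
  · rw [lp.norm_single (by simp), norm_mul, norm_phase, one_mul]

lemma continuous_propagator {τ : ℝ → ℝ} {g : ℝ → FourierL1 n} (hτ : Continuous τ)
    (hg : Continuous g) : Continuous fun t => propagator (τ t) (g t) := by
  have h : Continuous fun p : ℝ × FourierL1 n => propagator p.1 p.2 :=
    continuous_prod_of_continuous_lipschitzWith' _ 1
      (fun t => (propagator t).lipschitz) continuous_propagator_apply
  exact h.comp (hτ.prodMk hg)

/-! ### The Duhamel formula in `ℓ¹(ℤⁿ)` -/

variable {ρ : ℕ} {lam : ℂ} {a b : FourierL1 n}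

/-- The forcing along a curve, pulled back to time zero by the free group. -/
noncomputable def pulledForcing (ρ : ℕ) (lam : ℂ) (b : FourierL1 n) (V : ℝ → FourierL1 n)
    (s : ℝ) : FourierL1 n :=
  propagator (-s) (forcing ρ lam b (V s))

lemma duhamel_apply {V : ℝ → FourierL1 n} {t : ℝ}
    (hV : IntervalIntegrable (pulledForcing ρ lam b V) volume 0 t) (m : Fin n → ℤ) :
    propagator t (a + ∫ s in (0 : ℝ)..t, pulledForcing ρ lam b V s) m =
      Complex.exp (-(4 * (Real.pi : ℂ) ^ 2) * Complex.I *
          ((∑ i, (m i : ℝ) ^ 2 : ℝ) : ℂ) * (t : ℂ)) * a m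
        + ∫ s in (0 : ℝ)..t,
            Complex.exp (-(4 * (Real.pi : ℂ) ^ 2) * Complex.I *
                ((∑ i, (m i : ℝ) ^ 2 : ℝ) : ℂ) * ((t : ℂ) - (s : ℂ))) *
              ((∑' ξ : Fin n → ℤ, b (m - ξ) * V s ξ) + lam * dConvPow (V s) ρ m) := by
  have h := (lp.evalCLM ℝ (fun _ : Fin n → ℤ => ℂ) 1 m).intervalIntegral_comp_comm hV
  change ∫ s in (0 : ℝ)..t, pulledForcing ρ lam b V s m =
    (∫ s in (0 : ℝ)..t, pulledForcing ρ lam b V s) m at h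
  rw [propagator_apply, lp.coeFn_add, Pi.add_apply, mul_add, ← h,
    ← intervalIntegral.integral_const_mul]
  refine congrArg₂ _ rfl (intervalIntegral.integral_congr fun s _ => ?_)
  simp only [pulledForcing]
  rw [propagator_apply, forcing_apply, ← mul_assoc, ← phase_add, phase]
  push_cast
  rfl

lemma norm_forcing_le (hρ : 1 ≤ ρ) {r : ℝ} (hr : 0 ≤ r) {K : ℝ≥0}
    (hK : ∀ f g : FourierL1 n, ‖f‖ ≤ r → ‖g‖ ≤ r →
      ‖forcing ρ lam b f - forcing ρ lam b g‖ ≤ K * ‖f - g‖)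
    {f : FourierL1 n} (hf : ‖f‖ ≤ r) : ‖forcing ρ lam b f‖ ≤ K * r := by
  have h := hK f 0 hf (by simpa using hr)
  rw [forcing_zero hρ, sub_zero, sub_zero] at h
  exact h.trans (by gcongr)

lemma intervalIntegrable_pulledForcing (hρ : 1 ≤ ρ) {r : ℝ} (hr : 0 ≤ r) {K : ℝ≥0}
    (hK : ∀ f g : FourierL1 n, ‖f‖ ≤ r → ‖g‖ ≤ r →
      ‖forcing ρ lam b f - forcing ρ lam b g‖ ≤ K * ‖f - g‖)
    {V : ℝ → FourierL1 n} (hV : StronglyMeasurable V) (hVr : ∀ s, ‖V s‖ ≤ r) (t : ℝ) :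
    IntervalIntegrable (pulledForcing ρ lam b V) volume 0 t := by
  have hm : StronglyMeasurable (pulledForcing ρ lam b V) := by
    refine stronglyMeasurable_of_apply fun m => ?_
    have hc : Measurable fun s => forcing ρ lam b (V s) m :=
      ((lp.evalCLM ℂ (fun _ : Fin n → ℤ => ℂ) 1 m).continuous.comp
        (continuous_forcing ρ lam b)).comp_stronglyMeasurable hV |>.measurable
    exact ((continuous_phase m).comp continuous_neg).measurable.mul hc
  refine (intervalIntegrable_const (c := (K * r : ℝ))).mono_fun hm.aestronglyMeasurable
    (.of_forall fun s => ?_)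
  rw [Real.norm_of_nonneg (by positivity)]
  refine ((propagator (-s)).norm_map _).trans_le ?_
  exact norm_forcing_le hρ hr hK (hVr s)

/-- Bounded measurable solutions of the Duhamel equation coincide on a short time interval. -/
lemma duhamel_unique (hρ : 1 ≤ ρ) {r T : ℝ} (hr : 0 ≤ r) {K : ℝ≥0}
    (hK : ∀ f g : FourierL1 n, ‖f‖ ≤ r → ‖g‖ ≤ r →
      ‖forcing ρ lam b f - forcing ρ lam b g‖ ≤ K * ‖f - g‖) (hKT : K * T ≤ 1 / 2)
    {V W : ℝ → FourierL1 n} (hVm : StronglyMeasurable V) (hWm : StronglyMeasurable W)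
    (hVr : ∀ s, ‖V s‖ ≤ r) (hWr : ∀ s, ‖W s‖ ≤ r)
    (hV : ∀ t ∈ Ioo (-T) T,
      V t = propagator t (a + ∫ s in (0 : ℝ)..t, pulledForcing ρ lam b V s))
    (hW : ∀ t ∈ Ioo (-T) T,
      W t = propagator t (a + ∫ s in (0 : ℝ)..t, pulledForcing ρ lam b W s)) :
    ∀ t ∈ Ioo (-T) T, V t = W t := by
  have key : ∀ k : ℕ, ∀ t ∈ Ioo (-T) T, ‖V t - W t‖ ≤ 2 * r * (1 / 2) ^ k := by
    intro k
    induction k with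
    | zero =>
      intro t _
      linarith [norm_sub_le (V t) (W t), hVr t, hWr t]
    | succ k ih =>
      intro t ht
      rw [hV t ht, hW t ht, ← map_sub, LinearIsometry.norm_map, add_sub_add_left_eq_sub,
        ← intervalIntegral.integral_sub
          (intervalIntegrable_pulledForcing hρ hr hK hVm hVr t)
          (intervalIntegrable_pulledForcing hρ hr hK hWm hWr t)]
      have hb : ‖∫ s in (0 : ℝ)..t, pulledForcing ρ lam b V s - pulledForcing ρ lam b W s‖
          ≤ K * (2 * r * (1 / 2) ^ k) * |t - 0| := by
        refine intervalIntegral.norm_integral_le_of_norm_le_const fun s hs => ?_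
        rw [pulledForcing, pulledForcing, ← map_sub, LinearIsometry.norm_map]
        refine (hK _ _ (hVr s) (hWr s)).trans ?_
        gcongr
        refine ih s ?_
        rcases mem_uIoc.1 hs with h | h
        · exact ⟨by linarith [ht.1, ht.2, h.1, h.2], by linarith [ht.2, h.2]⟩
        · exact ⟨by linarith [ht.1, h.1], by linarith [ht.1, ht.2, h.1, h.2]⟩
      have hT : |t - 0| ≤ T := by rw [sub_zero]; exact (abs_lt.2 ht).le
      calc _ ≤ K * (2 * r * (1 / 2) ^ k) * |t - 0| := hb
        _ ≤ K * (2 * r * (1 / 2) ^ k) * T := by gcongr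
        _ = (K * T) * (2 * r * (1 / 2) ^ k) := by ring
        _ ≤ 1 / 2 * (2 * r * (1 / 2) ^ k) := by gcongr
        _ = 2 * r * (1 / 2) ^ (k + 1) := by ring
  intro t ht
  have hlim : Tendsto (fun k : ℕ => 2 * r * (1 / 2 : ℝ) ^ k) atTop (𝓝 0) := by
    simpa using (tendsto_pow_atTop_nhds_zero_of_lt_one (r := (1 / 2 : ℝ)) (by norm_num)
      (by norm_num)).const_mul (2 * r)
  rw [← sub_eq_zero, ← norm_le_zero_iff]
  exact ge_of_tendsto' hlim fun k => key k t ht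

/-- The Duhamel equation has a continuous solution in the ball of radius `2‖a‖` on a short time
interval. -/
lemma exists_duhamel (hρ : 1 ≤ ρ) {T : ℝ} (hT : 0 < T) {K : ℝ≥0}
    (hK : ∀ f g : FourierL1 n, ‖f‖ ≤ 2 * ‖a‖ → ‖g‖ ≤ 2 * ‖a‖ →
      ‖forcing ρ lam b f - forcing ρ lam b g‖ ≤ K * ‖f - g‖) (hKT : K * T ≤ 1 / 2) :
    ∃ V : ℝ → FourierL1 n, Continuous V ∧ (∀ t, ‖V t‖ ≤ 2 * ‖a‖) ∧
      ∀ t ∈ Ioo (-T) T,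
        V t = propagator t (a + ∫ s in (0 : ℝ)..t, pulledForcing ρ lam b V s) := by
  have hr : 0 ≤ 2 * ‖a‖ := by positivity
  have hball : ∀ (t : ℝ), ∀ f ∈ closedBall a ‖a‖₊, ‖propagator t f‖ ≤ 2 * ‖a‖ := by
    intro t f hf
    rw [LinearIsometry.norm_map]
    rw [mem_closedBall_iff_norm, coe_nnnorm] at hf
    linarith [norm_le_norm_add_norm_sub' f a]
  have hPL : IsPicardLindelof
      (fun t f => propagator (-t) (forcing ρ lam b (propagator t f)))
      (⟨0, by constructor <;> linarith⟩ : Icc (-T) T) a ‖a‖₊ 0 (K * (2 * ‖a‖₊)) K := by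
    refine ⟨fun t _ => LipschitzOnWith.of_dist_le_mul fun f hf g hg => ?_, fun f _ => ?_,
      fun t _ f hf => ?_, ?_⟩
    · rw [LinearIsometry.dist_map, dist_eq_norm, dist_eq_norm]
      refine (hK _ _ (hball t f hf) (hball t g hg)).trans ?_
      rw [← map_sub, LinearIsometry.norm_map]
    · exact (continuous_propagator continuous_neg
        ((continuous_forcing ρ lam b).comp (continuous_propagator_apply f))).continuousOn
    · rw [LinearIsometry.norm_map]
      exact norm_forcing_le hρ hr hK (hball t f hf)
    · have := mul_le_mul_of_nonneg_right hKT hr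
      simp only [sub_zero, zero_sub, neg_neg, max_self, NNReal.coe_zero]
      push_cast
      linarith
  obtain ⟨α, hα⟩ := ODE.FunSpace.exists_isFixedPt_next hPL (x := a) (by simp)
  refine ⟨fun t => propagator t (α.compProj t),
    continuous_propagator continuous_id α.continuous_compProj,
    fun t => hball t _ (α.compProj_mem_closedBall hPL.mul_max_le), fun t ht => ?_⟩
  have ht' : t ∈ Icc (-T) T := Ioo_subset_Icc_self ht
  refine congrArg (propagator t) ?_
  calc α.compProj t = (ODE.FunSpace.next hPL (x := a) (by simp) α).compProj t := by rw [hα]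
    _ = _ := by
      rw [ODE.FunSpace.compProj_apply, ODE.FunSpace.next_apply, projIcc_of_mem _ ht']
      rfl

/-- A mild solution agrees with a bounded measurable `ℓ¹`-valued curve solving the Duhamel
equation. -/
lemma exists_duhamel_of_isMildSol (hρ : 1 ≤ ρ) {T : ℝ} {K : ℝ≥0}
    (hK : ∀ f g : FourierL1 n, ‖f‖ ≤ 2 * ‖a‖ → ‖g‖ ≤ 2 * ‖a‖ →
      ‖forcing ρ lam b f - forcing ρ lam b g‖ ≤ K * ‖f - g‖)
    {v : ℝ → (Fin n → ℤ) → ℂ} (hv : IsMildSol ρ lam a b T v) :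
    ∃ V : ℝ → FourierL1 n, StronglyMeasurable V ∧ (∀ t, ‖V t‖ ≤ 2 * ‖a‖) ∧
      (∀ t ∈ Ioo (-T) T, v t = V t) ∧
      ∀ t ∈ Ioo (-T) T,
        V t = propagator t (a + ∫ s in (0 : ℝ)..t, pulledForcing ρ lam b V s) := by
  classical
  obtain ⟨hsum, hmeas, hle, heq⟩ := hv
  let V : ℝ → FourierL1 n := fun t =>
    if ht : t ∈ Ioo (-T) T then ⟨v t, memℓp_one_iff.2 (hsum t ht)⟩ else 0
  have hVv : ∀ t ∈ Ioo (-T) T, v t = V t := fun t ht => by simp only [V, dif_pos ht]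
  have hVm : StronglyMeasurable V := by
    refine stronglyMeasurable_of_apply fun m => ?_
    have h : (fun s => V s m) = (Ioo (-T) T).indicator fun s => v s m := by
      ext s
      by_cases hs : s ∈ Ioo (-T) T
      · rw [indicator_of_mem hs, hVv s hs]
      · rw [indicator_of_notMem hs]
        simp only [V, dif_neg hs]
        rfl
    rw [h]
    exact (hmeas m).indicator measurableSet_Ioo
  have hVr : ∀ t, ‖V t‖ ≤ 2 * ‖a‖ := by
    intro t
    by_cases ht : t ∈ Ioo (-T) T
    · rw [norm_eq_tsum, norm_eq_tsum, ← hVv t ht]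
      exact hle t ht
    · simp only [V, dif_neg ht, norm_zero]
      positivity
  refine ⟨V, hVm, hVr, hVv, fun t ht => ?_⟩
  ext m
  rw [duhamel_apply (intervalIntegrable_pulledForcing hρ (by positivity) hK hVm hVr t),
    ← hVv t ht, heq t ht m]
  refine congrArg₂ _ rfl (intervalIntegral.integral_congr fun s hs => ?_)
  have hs' : s ∈ Ioo (-T) T := by
    have h0 : (0 : ℝ) ∈ Ioo (-T) T := ⟨by linarith [ht.1, ht.2], by linarith [ht.1, ht.2]⟩
    exact ordConnected_Ioo.uIcc_subset h0 ht hs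
  simp only [hVv s hs']

lemma isMildSol_of_duhamel (hρ : 1 ≤ ρ) {T : ℝ} {K : ℝ≥0}
    (hK : ∀ f g : FourierL1 n, ‖f‖ ≤ 2 * ‖a‖ → ‖g‖ ≤ 2 * ‖a‖ →
      ‖forcing ρ lam b f - forcing ρ lam b g‖ ≤ K * ‖f - g‖)
    {V : ℝ → FourierL1 n} (hVc : Continuous V) (hVr : ∀ t, ‖V t‖ ≤ 2 * ‖a‖)
    (hV : ∀ t ∈ Ioo (-T) T,
      V t = propagator t (a + ∫ s in (0 : ℝ)..t, pulledForcing ρ lam b V s)) :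
    IsMildSol ρ lam a b T fun t => V t := by
  refine ⟨fun t _ => summable_norm (V t), fun m => ?_, fun t _ => ?_, fun t ht m => ?_⟩
  · exact ((lp.evalCLM ℂ (fun _ : Fin n → ℤ => ℂ) 1 m).continuous.comp hVc).measurable
  · rw [← norm_eq_tsum, ← norm_eq_tsum]
    exact hVr t
  · rw [← duhamel_apply (intervalIntegrable_pulledForcing hρ (by positivity) hK
      hVc.stronglyMeasurable hVr t), ← hV t ht]

end FourierL1

open FourierL1

theorem stmt19 (n : ℕ) (hn : 1 ≤ n) (ρ : ℕ) (hρ : 1 ≤ ρ)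
    (lam : ℂ) (hlam : lam = 1 ∨ lam = -1)
    (a₀ b : (Fin n → ℤ) → ℂ)
    (ha : Summable fun m => ‖a₀ m‖) (hb : Summable fun m => ‖b m‖) :
    ∃ T : ℝ, 0 < T ∧ ∃ u : ℝ → (Fin n → ℤ) → ℂ,
      IsMildSol ρ lam a₀ b T u ∧
      ∀ v : ℝ → (Fin n → ℤ) → ℂ, IsMildSol ρ lam a₀ b T v →
        ∀ t ∈ Set.Ioo (-T) T, v t = u t := by
  obtain ⟨a, rfl⟩ : ∃ a : FourierL1 n, a = a₀ := ⟨⟨a₀, memℓp_one_iff.2 ha⟩, rfl⟩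
  obtain ⟨b, rfl⟩ : ∃ b' : FourierL1 n, b' = b := ⟨⟨b, memℓp_one_iff.2 hb⟩, rfl⟩
  have hr : 0 ≤ 2 * ‖a‖ := by positivity
  obtain ⟨K, hK⟩ := exists_norm_forcing_sub_le ρ lam b hr
  have hT : (0 : ℝ) < 1 / (2 * (K + 1)) := by positivity
  have hKT : K * (1 / (2 * (K + 1)) : ℝ) ≤ 1 / 2 := by
    rw [mul_one_div, div_le_div_iff₀ (by positivity) two_pos]
    linarith
  obtain ⟨V, hVc, hVr, hV⟩ := exists_duhamel hρ hT hK hKT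
  refine ⟨_, hT, fun t => V t, isMildSol_of_duhamel hρ hK hVc hVr hV, fun v hv t ht => ?_⟩
  obtain ⟨W, hWm, hWr, hvW, hW⟩ := exists_duhamel_of_isMildSol hρ hK hv
  rw [hvW t ht, duhamel_unique hρ hr hK hKT hWm hVc.stronglyMeasurable hWr hVr hW hV t ht]
end
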